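/- Asymptotics of the conjectured minimum distance (Lemma 3): Fix an integer T ≥ 2. There exist a constant K > 0 and an integer B* such that for all integers B0 ≥ B*, |log₂(d̃(T,B0)) + (1/(2(T−1)))·log₂(n(B0)) + (1/2)·log₂(log₂(n(B0)))| ≤ K, where n(B0) = T·2^{2(T−1)B0} is the constellation size; equivalently, log₂(d̃(T,B0)) = −B0 − (1/2)log₂(B0) + O(1) as B0 → ∞. -/

import Mathlib

open MeasureTheory
open scoped BigOperators

/-- The standard normal cumulative distribution function. -/
noncomputable def stdNormalCDF (x : ℝ) : ℝ :=
  ∫ t in Set.Iic x, (Real.sqrt (2 * Real.pi))⁻¹ * Real.exp (-t ^ 2 / 2)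

/-- The conjectured minimum distance `d̃(T,B0)`, expressed via the quantiles
`m0`, `m1`: with `α`, `β`, `φ` as in the paper,
`d̃ = sqrt(1 − |1 + (α/(α+β))·(e^{2iφ} − 1)|²)`. -/
noncomputable def dtilde (T : ℕ) (m0 m1 : ℝ) : ℝ :=
  let α : ℝ := (1 - Real.exp (-(m0 ^ 2 + m1 ^ 2) / 2)) / (1 + Real.exp (-(m0 ^ 2 + m1 ^ 2) / 2))
  let β : ℝ := 1 + ((T : ℝ) - 2) * (1 - Real.exp (-m0 ^ 2)) / (1 + Real.exp (-m0 ^ 2))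
  let φ : ℝ := Real.arctan (m1 / m0)
  Real.sqrt (1 - ‖(1 : ℂ) + ((α / (α + β) : ℝ) : ℂ) *
    (Complex.exp (2 * Complex.I * (φ : ℂ)) - 1)‖ ^ 2)

/-- The density of the standard normal distribution. -/
noncomputable def stdNormalPDF (t : ℝ) : ℝ :=
  (Real.sqrt (2 * Real.pi))⁻¹ * Real.exp (-t ^ 2 / 2)

lemma integrable_stdNormalPDF : Integrable stdNormalPDF := by
  have h := (integrable_exp_neg_mul_sq (b := 1 / 2) (by norm_num)).const_mul
    (Real.sqrt (2 * Real.pi))⁻¹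
  refine h.congr (Filter.Eventually.of_forall fun t => ?_)
  simp only [stdNormalPDF]
  congr 2
  ring

lemma stdNormalPDF_nonneg (t : ℝ) : 0 ≤ stdNormalPDF t := by
  unfold stdNormalPDF; positivity

lemma stdNormalPDF_le_of_sq_le {s t : ℝ} (h : s ^ 2 ≤ t ^ 2) :
    stdNormalPDF t ≤ stdNormalPDF s := by
  unfold stdNormalPDF
  gcongr

lemma integral_stdNormalPDF : ∫ t, stdNormalPDF t = 1 := by
  have h : stdNormalPDF = fun t : ℝ =>
      (Real.sqrt (2 * Real.pi))⁻¹ * Real.exp (-(1 / 2) * t ^ 2) := by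
    funext t; simp only [stdNormalPDF]; congr 2; ring
  have hp : Real.sqrt (2 * Real.pi) ≠ 0 := by positivity
  rw [h, integral_const_mul, integral_gaussian]
  rw [show Real.pi / (1 / 2) = 2 * Real.pi by ring, inv_mul_cancel₀ hp]

lemma stdNormalCDF_zero : stdNormalCDF 0 = 1 / 2 := by
  have hsym : ∫ t in Set.Ioi (0 : ℝ), stdNormalPDF t = ∫ t in Set.Iic (0 : ℝ), stdNormalPDF t := by
    have h := integral_comp_neg_Iic (0 : ℝ) stdNormalPDF
    simp only [stdNormalPDF, neg_zero, even_two.neg_pow] at h ⊢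
    exact h.symm
  have hadd := intervalIntegral.integral_Iic_add_Ioi (b := (0 : ℝ)) (μ := volume)
    integrable_stdNormalPDF.integrableOn integrable_stdNormalPDF.integrableOn
  rw [integral_stdNormalPDF, hsym] at hadd
  change ∫ t in Set.Iic (0 : ℝ), stdNormalPDF t = 1 / 2
  linarith

lemma stdNormalCDF_sub (a b : ℝ) :
    stdNormalCDF b - stdNormalCDF a = ∫ t in a..b, stdNormalPDF t :=
  intervalIntegral.integral_Iic_sub_Iic integrable_stdNormalPDF.integrableOn
    integrable_stdNormalPDF.integrableOn

lemma stdNormalCDF_mono : Monotone stdNormalCDF := fun a b hab => by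
  have h := intervalIntegral.integral_nonneg (μ := volume) hab fun t _ => stdNormalPDF_nonneg t
  rw [← stdNormalCDF_sub] at h
  linarith

lemma mul_le_stdNormalCDF_sub {a b c : ℝ} (hab : a ≤ b)
    (h : ∀ t ∈ Set.Icc a b, c ≤ stdNormalPDF t) :
    (b - a) * c ≤ stdNormalCDF b - stdNormalCDF a := by
  rw [stdNormalCDF_sub, ← smul_eq_mul, ← intervalIntegral.integral_const]
  exact intervalIntegral.integral_mono_on hab intervalIntegrable_const
    integrable_stdNormalPDF.intervalIntegrable h

lemma stdNormalCDF_sub_le_mul {a b c : ℝ} (hab : a ≤ b)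
    (h : ∀ t ∈ Set.Icc a b, stdNormalPDF t ≤ c) :
    stdNormalCDF b - stdNormalCDF a ≤ (b - a) * c := by
  rw [stdNormalCDF_sub, ← smul_eq_mul, ← intervalIntegral.integral_const]
  exact intervalIntegral.integral_mono_on hab integrable_stdNormalPDF.intervalIntegrable
    intervalIntegrable_const h

/-- The Chernoff bound for the lower Gaussian tail. -/
lemma stdNormalCDF_le_exp {x : ℝ} (hx : x ≤ 0) : stdNormalCDF x ≤ Real.exp (-x ^ 2 / 2) := by
  have hint : Integrable fun t => Real.exp (-x ^ 2 / 2) * stdNormalPDF (t - x) :=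
    (integrable_stdNormalPDF.comp_sub_right x).const_mul _
  calc stdNormalCDF x = ∫ t in Set.Iic x, stdNormalPDF t := rfl
    _ ≤ ∫ t in Set.Iic x, Real.exp (-x ^ 2 / 2) * stdNormalPDF (t - x) := by
      refine setIntegral_mono_on integrable_stdNormalPDF.integrableOn hint.integrableOn
        measurableSet_Iic fun t ht => ?_
      have ht' : t ≤ x := ht
      simp only [stdNormalPDF]
      rw [mul_left_comm, ← Real.exp_add]
      gcongr
      nlinarith [mul_nonneg_of_nonpos_of_nonpos hx (sub_nonpos.2 ht')]
    _ ≤ ∫ t, Real.exp (-x ^ 2 / 2) * stdNormalPDF (t - x) :=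
      setIntegral_le_integral hint (Filter.Eventually.of_forall fun t =>
        mul_nonneg (Real.exp_nonneg _) (stdNormalPDF_nonneg _))
    _ = Real.exp (-x ^ 2 / 2) := by
      rw [integral_const_mul, integral_sub_right_eq_self stdNormalPDF x, integral_stdNormalPDF,
        mul_one]

lemma stdNormalPDF_sub_one_le_stdNormalCDF {x : ℝ} (hx : x ≤ 0) :
    stdNormalPDF (x - 1) ≤ stdNormalCDF x := by
  have h := mul_le_stdNormalCDF_sub (c := stdNormalPDF (x - 1)) (sub_le_self x zero_le_one)
    fun t ht => stdNormalPDF_le_of_sq_le (by nlinarith [ht.1, ht.2])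
  have h0 : 0 ≤ stdNormalCDF (x - 1) := integral_nonneg stdNormalPDF_nonneg
  linarith

lemma sqrt_two_pi_mem : Real.sqrt (2 * Real.pi) ∈ Set.Icc (1 : ℝ) 3 := by
  constructor
  · exact Real.one_le_sqrt.2 (by linarith [Real.pi_gt_three])
  · exact Real.sqrt_le_iff.2 ⟨by norm_num, by linarith [Real.pi_lt_four]⟩

lemma stdNormalPDF_zero_le_one : stdNormalPDF 0 ≤ 1 := by
  have h := sqrt_two_pi_mem.1
  simpa [stdNormalPDF] using inv_le_one_of_one_le₀ h

lemma one_sixth_le_stdNormalPDF_one : 1 / 6 ≤ stdNormalPDF 1 := by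
  obtain ⟨h1, h3⟩ := sqrt_two_pi_mem
  have hi : (3 : ℝ)⁻¹ ≤ (Real.sqrt (2 * Real.pi))⁻¹ := by gcongr
  have he : (1 / 2 : ℝ) ≤ Real.exp (-1 ^ 2 / 2) := by
    have := Real.add_one_le_exp (-1 ^ 2 / 2 : ℝ)
    linarith
  calc (1 / 6 : ℝ) = 3⁻¹ * (1 / 2) := by norm_num
    _ ≤ _ := by unfold stdNormalPDF; gcongr

/-- Near the median, a normal quantile is comparable to the excess probability. -/
lemma quantile_near_median {x ε : ℝ} (h0 : 0 < ε) (h1 : ε < 1 / 6)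
    (hx : stdNormalCDF x = 1 / 2 + ε) : ε ≤ x ∧ x ≤ 6 * ε := by
  have hc := one_sixth_le_stdNormalPDF_one
  have hpos : 0 < x := by
    by_contra! h
    have := stdNormalCDF_mono h
    rw [stdNormalCDF_zero] at this
    linarith
  have hup : ε ≤ x := by
    have h := stdNormalCDF_sub_le_mul (c := 1) hpos.le fun t _ =>
      (stdNormalPDF_le_of_sq_le (by nlinarith [sq_nonneg t])).trans stdNormalPDF_zero_le_one
    rw [hx, stdNormalCDF_zero] at h
    linarith
  have key {y : ℝ} (hy0 : 0 ≤ y) (hy1 : y ≤ 1) : y / 6 ≤ stdNormalCDF y - 1 / 2 := by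
    have h := mul_le_stdNormalCDF_sub (c := 1 / 6) hy0 fun t ht =>
      hc.trans (stdNormalPDF_le_of_sq_le (by nlinarith [ht.1, ht.2]))
    rw [stdNormalCDF_zero] at h
    linarith
  have hx1 : x ≤ 1 := by
    by_contra! h
    have := stdNormalCDF_mono h.le
    have := key zero_le_one le_rfl
    linarith
  refine ⟨hup, ?_⟩
  have := key hpos.le hx1
  linarith

/-- The square of the quantile at level `2 ^ (-B - 1)` grows linearly in `B`. -/
lemma sq_quantile_tail {x B : ℝ} (hB : 30 ≤ B) (hx : stdNormalCDF x = (2 : ℝ) ^ (-B - 1)) :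
    B / 2 ≤ x ^ 2 ∧ x ^ 2 ≤ 4 * B := by
  have hl1 := Real.log_two_gt_d9
  have hl2 := Real.log_two_lt_d9
  have hexp : (2 : ℝ) ^ (-B - 1) = Real.exp (Real.log 2 * (-B - 1)) :=
    Real.rpow_def_of_pos two_pos _
  have hneg : x ≤ 0 := by
    by_contra! h
    have h' := stdNormalCDF_mono h.le
    have : (2 : ℝ) ^ (-B - 1) ≤ 2 ^ (-2 : ℝ) :=
      Real.rpow_le_rpow_of_exponent_le one_le_two (by linarith)
    rw [stdNormalCDF_zero, hx] at h'
    norm_num [Real.rpow_neg] at this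
    linarith
  constructor
  · have h := stdNormalPDF_sub_one_le_stdNormalCDF hneg
    obtain ⟨hs1, hs3⟩ := sqrt_two_pi_mem
    have hi : Real.exp (-2) ≤ (Real.sqrt (2 * Real.pi))⁻¹ := by
      rw [Real.exp_neg]
      have := Real.add_one_le_exp (2 : ℝ)
      gcongr
      linarith
    rw [hx, hexp] at h
    have h2 : Real.exp (-2 + -(x - 1) ^ 2 / 2) ≤ Real.exp (Real.log 2 * (-B - 1)) := by
      rw [Real.exp_add]
      refine le_trans ?_ h
      unfold stdNormalPDF
      gcongr
    have h3 := Real.exp_le_exp.1 h2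
    nlinarith [sq_nonneg (x + 1)]
  · have h := stdNormalCDF_le_exp hneg
    rw [hx, hexp] at h
    have h3 := Real.exp_le_exp.1 h
    nlinarith

lemma one_sub_norm_sq_one_add_mul_exp_sub_one (r φ : ℝ) :
    1 - ‖(1 : ℂ) + (r : ℂ) * (Complex.exp (2 * Complex.I * (φ : ℂ)) - 1)‖ ^ 2 =
      4 * (r * (1 - r)) * Real.sin φ ^ 2 := by
  have he : Complex.exp (2 * Complex.I * (φ : ℂ)) =
      (Real.cos (2 * φ) : ℂ) + (Real.sin (2 * φ) : ℂ) * Complex.I := by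
    rw [show 2 * Complex.I * (φ : ℂ) = ((2 * φ : ℝ) : ℂ) * Complex.I by push_cast; ring,
      Complex.exp_mul_I, Complex.ofReal_cos, Complex.ofReal_sin]
  rw [he, Complex.sq_norm, Complex.normSq_apply]
  simp only [Complex.add_re, Complex.add_im, Complex.mul_re, Complex.mul_im, Complex.sub_re,
    Complex.sub_im, Complex.one_re, Complex.one_im, Complex.ofReal_re, Complex.ofReal_im,
    Complex.I_re, Complex.I_im]
  have h1 := Real.sin_sq_add_cos_sq (2 * φ)
  have h2 := Real.cos_two_mul φ
  have h3 := Real.sin_sq_add_cos_sq φ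
  linear_combination (-r ^ 2) * h1 - 2 * r * (1 - r) * h2 - 4 * r * (1 - r) * h3

lemma sin_arctan_sq (x : ℝ) : Real.sin (Real.arctan x) ^ 2 = x ^ 2 / (1 + x ^ 2) := by
  rw [Real.sin_arctan, div_pow, Real.sq_sqrt (by positivity)]

/-- `d̃²` is comparable to `m₁² / (m₀² + m₁²)` once `m₀² ≥ 4`. -/
lemma dtilde_eq_sqrt {T : ℕ} (hT : 2 ≤ T) {x y : ℝ} (hx : 4 ≤ x ^ 2) :
    ∃ κ : ℝ, 2 / (T : ℝ) ^ 2 ≤ κ ∧ κ ≤ 1 ∧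
      dtilde T x y = Real.sqrt (κ * (y ^ 2 / (x ^ 2 + y ^ 2))) := by
  have hT' : (2 : ℝ) ≤ T := by exact_mod_cast hT
  have hx0 : x ≠ 0 := by rintro rfl; norm_num at hx
  have hx0' : 0 < x ^ 2 := by positivity
  have hE2 : Real.exp (-2) ≤ 1 / 3 := by
    rw [Real.exp_neg, one_div]
    have := Real.add_one_le_exp (2 : ℝ)
    gcongr
    linarith
  dsimp only [dtilde]
  set α := (1 - Real.exp (-(x ^ 2 + y ^ 2) / 2)) / (1 + Real.exp (-(x ^ 2 + y ^ 2) / 2))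
  set β := 1 + ((T : ℝ) - 2) * (1 - Real.exp (-x ^ 2)) / (1 + Real.exp (-x ^ 2))
  have hα : 1 / 2 ≤ α ∧ α ≤ 1 := by
    have hE : Real.exp (-(x ^ 2 + y ^ 2) / 2) ≤ 1 / 3 :=
      (Real.exp_le_exp.2 (by nlinarith [sq_nonneg y])).trans hE2
    have hE0 := Real.exp_pos (-(x ^ 2 + y ^ 2) / 2)
    constructor
    · rw [le_div_iff₀ (by positivity)]; linarith
    · rw [div_le_one (by positivity)]; linarith
  have hβ : 1 ≤ β ∧ β ≤ T - 1 := by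
    have hE : Real.exp (-x ^ 2) ≤ 1 := Real.exp_le_one_iff.2 (by linarith)
    have hE0 := Real.exp_pos (-x ^ 2)
    have h0 : 0 ≤ ((T : ℝ) - 2) * (1 - Real.exp (-x ^ 2)) / (1 + Real.exp (-x ^ 2)) :=
      div_nonneg (mul_nonneg (by linarith) (by linarith)) (by positivity)
    have h1 : ((T : ℝ) - 2) * (1 - Real.exp (-x ^ 2)) / (1 + Real.exp (-x ^ 2)) ≤ T - 2 := by
      rw [div_le_iff₀ (by positivity)]
      nlinarith
    constructor <;> simp only [β] <;> linarith
  clear_value α β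
  obtain ⟨hα0, hα1⟩ := hα
  obtain ⟨hβ0, hβ1⟩ := hβ
  have hs : 0 < α + β := by linarith
  refine ⟨4 * (α / (α + β) * (1 - α / (α + β))), ?_, ?_, ?_⟩
  · rw [show 4 * (α / (α + β) * (1 - α / (α + β))) = 4 * (α * β) / (α + β) ^ 2 by field_simp; ring]
    have : 1 / 2 ≤ α * β := by nlinarith
    gcongr <;> linarith
  · nlinarith [sq_nonneg (2 * (α / (α + β)) - 1)]
  · rw [one_sub_norm_sq_one_add_mul_exp_sub_one, sin_arctan_sq]
    congr 2
    field_simp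

/-- Two-sided bounds for `d̃`, of order `2 ^ (-B) / √B`. -/
lemma dtilde_bounds {T : ℕ} (hT : 2 ≤ T) {x y B : ℝ} (hB : 30 ≤ B)
    (hx : stdNormalCDF x = (2 : ℝ) ^ (-B - 1))
    (hy : stdNormalCDF y = 1 / 2 + (2 : ℝ) ^ (-B - 1)) :
    ∃ q : ℝ, dtilde T x y = Real.sqrt q ∧ (2 : ℝ) ^ (-2 * B) / B / (16 * (T : ℝ) ^ 2) ≤ q ∧
      q ≤ (2 : ℝ) ^ (-2 * B) / B * 18 := by
  obtain ⟨hx1, hx2⟩ := sq_quantile_tail hB hx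
  have hε0 : (0 : ℝ) < 2 ^ (-B - 1) := by positivity
  have hε1 : (2 : ℝ) ^ (-B - 1) ≤ 2 ^ (-3 : ℝ) :=
    Real.rpow_le_rpow_of_exponent_le one_le_two (by linarith)
  have hε2 : (2 : ℝ) ^ (-2 * B) = 4 * ((2 : ℝ) ^ (-B - 1)) ^ 2 := by
    rw [← Real.rpow_natCast, ← Real.rpow_mul two_pos.le,
      show (4 : ℝ) = 2 ^ (2 : ℝ) by norm_num, ← Real.rpow_add two_pos]
    congr 1
    push_cast
    ring
  rw [hε2]
  generalize (2 : ℝ) ^ (-B - 1) = ε at *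
  norm_num [Real.rpow_neg] at hε1
  obtain ⟨hy1, hy2⟩ := quantile_near_median hε0 (by linarith) hy
  obtain ⟨κ, hκ1, hκ2, hd⟩ := dtilde_eq_sqrt (y := y) hT (by linarith : 4 ≤ x ^ 2)
  have hT0 : (0 : ℝ) < T := by exact_mod_cast (by omega : 0 < T)
  have hB0 : 0 < B := by linarith
  have hκ0 : 0 ≤ κ := le_trans (by positivity) hκ1
  have hxy : 0 < x ^ 2 + y ^ 2 := add_pos_of_pos_of_nonneg (by linarith) (sq_nonneg y)
  have hyε : ε ^ 2 ≤ y ^ 2 := by gcongr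
  have hyε' : y ^ 2 ≤ 36 * ε ^ 2 := by nlinarith
  have hy4 : y ^ 2 ≤ 4 * B := by nlinarith
  refine ⟨_, hd, ?_, ?_⟩
  · calc 4 * ε ^ 2 / B / (16 * (T : ℝ) ^ 2) = 2 / (T : ℝ) ^ 2 * (ε ^ 2 / (4 * B + 4 * B)) := by
          field_simp; norm_num
      _ ≤ _ := by gcongr
  · calc κ * (y ^ 2 / (x ^ 2 + y ^ 2)) ≤ 1 * (36 * ε ^ 2 / (B / 2 + 0)) := by
          gcongr
          positivity
      _ = 4 * ε ^ 2 / B * 18 := by field_simp; ring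

/-- Asymptotics of the conjectured minimum distance (Lemma 3):
`log₂ d̃(T,B0) = −(1/(2(T−1)))log₂ n(B0) − (1/2)log₂ log₂ n(B0) + O(1)` where
`n(B0) = T·2^{2(T−1)B0}`. -/
theorem stmt_6 (T : ℕ) (hT : 2 ≤ T) (m0 m1 : ℕ → ℝ)
    (hm0 : ∀ B0 : ℕ, 1 ≤ B0 → stdNormalCDF (m0 B0) = (2 : ℝ) ^ (-(B0 : ℝ) - 1))
    (hm1 : ∀ B0 : ℕ, 1 ≤ B0 → stdNormalCDF (m1 B0) = 1 / 2 + (2 : ℝ) ^ (-(B0 : ℝ) - 1)) :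
    ∃ K : ℝ, 0 < K ∧ ∃ Bstar : ℕ, 1 ≤ Bstar ∧ ∀ B0 : ℕ, Bstar ≤ B0 →
      |Real.logb 2 (dtilde T (m0 B0) (m1 B0)) +
        (1 / (2 * ((T : ℝ) - 1))) * Real.logb 2 ((T : ℝ) * 2 ^ (2 * (T - 1) * B0)) +
        (1 / 2) * Real.logb 2 (Real.logb 2 ((T : ℝ) * 2 ^ (2 * (T - 1) * B0)))| ≤ K := by
  have hT' : (2 : ℝ) ≤ T := by exact_mod_cast hT
  have hlT : 0 ≤ Real.logb 2 T := Real.logb_nonneg one_lt_two (by linarith)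
  have hl3T : 0 ≤ Real.logb 2 (3 * T) := Real.logb_nonneg one_lt_two (by linarith)
  have hlT2 : 0 ≤ Real.logb 2 (16 * (T : ℝ) ^ 2) := Real.logb_nonneg one_lt_two (by nlinarith)
  have hl18 : 0 ≤ Real.logb 2 18 := Real.logb_nonneg one_lt_two (by norm_num)
  refine ⟨Real.logb 2 T + Real.logb 2 (3 * T) + Real.logb 2 (16 * (T : ℝ) ^ 2) +
    Real.logb 2 18 + 1, by positivity, 30, by norm_num, fun B hB => ?_⟩
  have hBr : (30 : ℝ) ≤ B := by exact_mod_cast hB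
  have hB0 : (0 : ℝ) < B := by linarith
  obtain ⟨q, hd, hq1, hq2⟩ := dtilde_bounds hT hBr (hm0 B (by omega)) (hm1 B (by omega))
  have hP : (0 : ℝ) < 2 ^ (-2 * (B : ℝ)) := by positivity
  have hq0 : 0 < q := lt_of_lt_of_le (by positivity) hq1
  have hmain : Real.logb 2 ((2 : ℝ) ^ (-2 * (B : ℝ)) / B) = -2 * B - Real.logb 2 B := by
    rw [Real.logb_div hP.ne' hB0.ne', Real.logb_rpow two_pos (by norm_num)]
  have hlow : -2 * B - Real.logb 2 B - Real.logb 2 (16 * (T : ℝ) ^ 2) ≤ Real.logb 2 q := by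
    rw [← hmain, ← Real.logb_div (by positivity) (by positivity)]
    exact Real.logb_le_logb_of_le one_lt_two (by positivity) hq1
  have hhigh : Real.logb 2 q ≤ -2 * B - Real.logb 2 B + Real.logb 2 18 := by
    rw [← hmain, ← Real.logb_mul (by positivity) (by norm_num)]
    exact Real.logb_le_logb_of_le one_lt_two hq0 hq2
  have hsqrt : Real.logb 2 (Real.sqrt q) = Real.logb 2 q / 2 := by
    rw [Real.logb, Real.log_sqrt hq0.le, Real.logb]
    ring
  have hL : Real.logb 2 ((T : ℝ) * 2 ^ (2 * (T - 1) * B)) =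
      Real.logb 2 T + 2 * ((T : ℝ) - 1) * B := by
    rw [Real.logb_mul (by positivity) (by positivity), Real.logb_pow,
      Real.logb_self_eq_one one_lt_two]
    push_cast [Nat.cast_sub (by omega : 1 ≤ T)]
    ring
  have hlTT : Real.logb 2 T ≤ T := by
    rw [Real.logb_le_iff_le_rpow one_lt_two (by linarith), Real.rpow_natCast]
    exact_mod_cast T.lt_two_pow_self.le
  rw [hd, hsqrt, hL]
  have hterm : 1 / (2 * ((T : ℝ) - 1)) * (Real.logb 2 T + 2 * ((T : ℝ) - 1) * B) =
      B + Real.logb 2 T / (2 * ((T : ℝ) - 1)) := by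
    have : (T : ℝ) - 1 ≠ 0 := by linarith
    field_simp
    ring
  have hfrac0 : 0 ≤ Real.logb 2 T / (2 * ((T : ℝ) - 1)) := div_nonneg hlT (by linarith)
  have hfrac1 : Real.logb 2 T / (2 * ((T : ℝ) - 1)) ≤ Real.logb 2 T :=
    div_le_self hlT (by linarith)
  have hll0 : Real.logb 2 B ≤ Real.logb 2 (Real.logb 2 T + 2 * ((T : ℝ) - 1) * B) :=
    Real.logb_le_logb_of_le one_lt_two hB0 (by nlinarith)
  have hll1 : Real.logb 2 (Real.logb 2 T + 2 * ((T : ℝ) - 1) * B) ≤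
      Real.logb 2 (3 * T) + Real.logb 2 B := by
    rw [← Real.logb_mul (by positivity) hB0.ne']
    exact Real.logb_le_logb_of_le one_lt_two (by nlinarith) (by nlinarith)
  rw [hterm, abs_le]
  constructor <;> linarith
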